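/- arXiv:2404.01191 — 3 statements merged into one kernel-verified Lean document; each statement's English description precedes it below -/
import Mathlib

section
/- Let I (observations) and S (latent states) be finite index sets with S nonempty, and let a, b : I × S → ℝ satisfy a(i,y) > 0 and b(i,y) > 0 for all i ∈ I, y ∈ S. Define posterior weights w(i,y) = a(i,y) / (∑_{y'∈S} a(i,y')). If ∑_{i∈I} ∑_{y∈S} w(i,y) · log b(i,y) ≥ ∑_{i∈I} ∑_{y∈S} w(i,y) · log a(i,y), then ∑_{i∈I} log(∑_{y∈S} b(i,y)) ≥ ∑_{i∈I} log(∑_{y∈S} a(i,y)). -/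
/-- Gibbs' inequality in the form needed for one observation. -/
theorem em_one {S : Type*} (s : Finset S) (hs : s.Nonempty) (a b : S → ℝ)
    (ha : ∀ y ∈ s, 0 < a y) (hb : ∀ y ∈ s, 0 < b y) :
    ∑ y ∈ s, (a y / ∑ z ∈ s, a z) * Real.log (b y)
      - ∑ y ∈ s, (a y / ∑ z ∈ s, a z) * Real.log (a y)
      ≤ Real.log (∑ y ∈ s, b y) - Real.log (∑ y ∈ s, a y) := by
  have hA : 0 < ∑ z ∈ s, a z := Finset.sum_pos ha hs
  have hB : 0 < ∑ z ∈ s, b z := Finset.sum_pos hb hs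
  have hwA : ∑ y ∈ s, a y / ∑ z ∈ s, a z = 1 := by
    rw [← Finset.sum_div, div_self hA.ne']
  have hwB : ∑ y ∈ s, b y / ∑ z ∈ s, b z = 1 := by
    rw [← Finset.sum_div, div_self hB.ne']
  generalize (∑ z ∈ s, a z) = A at *
  generalize (∑ z ∈ s, b z) = B at *
  have key : ∑ y ∈ s, (a y / A * Real.log (b y) - a y / A * Real.log (a y)
      - a y / A * (Real.log B - Real.log A)) ≤ ∑ y ∈ s, (b y / B - a y / A) := by
    refine Finset.sum_le_sum fun y hy => ?_
    have h1 := ha y hy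
    have h2 := hb y hy
    have h3 := Real.log_le_sub_one_of_pos (x := (b y * A) / (a y * B)) (by positivity)
    rw [Real.log_div (by positivity) (by positivity), Real.log_mul h2.ne' hA.ne',
      Real.log_mul h1.ne' hB.ne'] at h3
    have h4 := mul_le_mul_of_nonneg_left h3 (div_pos h1 hA).le
    have h5 : a y / A * (b y * A / (a y * B) - 1) = b y / B - a y / A := by
      field_simp
    rw [h5] at h4
    linarith
  rw [Finset.sum_sub_distrib, Finset.sum_sub_distrib, Finset.sum_sub_distrib,
    ← Finset.sum_mul, hwA, hwB] at key
  linarith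

/-- Generalized-EM ascent lemma for finite-mixture log-likelihoods: if an update does not
decrease the expected complete-data log-likelihood (with posterior weights
`w (i,y) = a (i,y) / ∑_{y'} a (i,y')` computed at the current parameter), then it does not
decrease the observed-data log-likelihood. -/
theorem em_ascent {I S : Type*} (sI : Finset I) (sS : Finset S) (hS : sS.Nonempty)
    (a b : I × S → ℝ)
    (ha : ∀ i ∈ sI, ∀ y ∈ sS, 0 < a (i, y))
    (hb : ∀ i ∈ sI, ∀ y ∈ sS, 0 < b (i, y))
    (h : ∑ i ∈ sI, ∑ y ∈ sS, (a (i, y) / ∑ y' ∈ sS, a (i, y')) * Real.log (b (i, y))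
        ≥ ∑ i ∈ sI, ∑ y ∈ sS, (a (i, y) / ∑ y' ∈ sS, a (i, y')) * Real.log (a (i, y))) :
    ∑ i ∈ sI, Real.log (∑ y ∈ sS, b (i, y))
      ≥ ∑ i ∈ sI, Real.log (∑ y ∈ sS, a (i, y)) := by
  have key := Finset.sum_le_sum fun i hi =>
    em_one sS hS (fun y => a (i, y)) (fun y => b (i, y)) (ha i hi) (hb i hi)
  rw [Finset.sum_sub_distrib, Finset.sum_sub_distrib] at key
  linarith
end

section
/- Fix integers n ≥ 1, N ≥ n, K ≥ 1, and d_g ≥ 1. Let g(x) = e^x/(1+e^x), g_y(w) = y g(w) + (1−y)(1−g(w)) for y ∈ {0,1}, and ℓ(y,w) = y log g(w) + (1−y) log(1−g(w)) for y ∈ [0,1]. Given labels k_i ∈ {0,1,…,K} for 1 ≤ i ≤ n and vectors v_i ∈ ℝ^{d_g} for 1 ≤ i ≤ N, consider parameters η = (λ, s, ξ) where λ = (λ_{yk})_{y∈{0,1},0≤k≤K} satisfies λ_{yk} ≥ 0, ∑_{k=0}^K λ_{yk} = 1 and λ_{y k_i} > 0 for every observed i, s = (s_{iy})_{1≤i≤N,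 y∈{0,1}} satisfies s_{iy} > 0 and ∑_{i=1}^N s_{iy} = 1 for each y, and ξ ∈ ℝ^{d_g}; define L(η) = ∑_{i=1}^n log(∑_{y=0}^1 λ_{y k_i} g_y(v_i^T ξ)) + ∑_{i=1}^N log(∑_{y=0}^1 s_{iy} g_y(v_i^T ξ)). Given a current η, define the E-step weights Ỹ_{i0} = λ_{1 k_i} g_1(v_i^T ξ) / ∑_{y=0}^1 λ_{y k_i} g_y(v_i^T ξ) for 1 ≤ i ≤ n and Ỹ_{i1} = s_{i1} g_1(v_i^T ξ) / ∑_{y=0}^1 s_{iy} g_y(v_i^T ξ) for 1 ≤ i ≤ N, writing Ỹ^{(1)} = Ỹ and Ỹ^{(0)} = 1 − Ỹ. Suppose η' = (λ', s', ξ') is defined by the M-step: λ'_{yk} = ∑_{i=1}^n 1{k_i = k} Ỹ_{i0}^{(y)} / ∑_{i=1}^n Ỹ_{i0}^{(y)}, s'_{iy} = Ỹ_{i1}^{(y)} / ∑_{i'=1}^N Ỹ_{i'1}^{(y)}, and ξ' is a global maximizer over ℝ^{d_g} of the function ξ'' ↦ ∑_{i=1}^n ℓ(Ỹ_{i0}, v_i^T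 ξ'') + ∑_{i=1}^N ℓ(Ỹ_{i1}, v_i^T ξ''). Then L(η') ≥ L(η). -/
/-- The expit (logistic) function `g(x) = eˣ/(1+eˣ)`. -/
noncomputable def expit (x : ℝ) : ℝ := Real.exp x / (1 + Real.exp x)

/-- `gY y w = y·g(w) + (1−y)·(1−g(w))` for `y ∈ {0,1}`. -/
noncomputable def gY (y : ℕ) (w : ℝ) : ℝ :=
  (y : ℝ) * expit w + (1 - (y : ℝ)) * (1 - expit w)

/-- `mix y t = y·t + (1−y)·(1−t)`: equals `t` when `y = 1` and `1−t` when `y = 0`. -/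
noncomputable def mix (y : ℕ) (t : ℝ) : ℝ := (y : ℝ) * t + (1 - (y : ℝ)) * (1 - t)

/-- The logistic log-likelihood `ℓ(y,w) = y log g(w) + (1−y) log(1−g(w))`. -/
noncomputable def loglik (y w : ℝ) : ℝ :=
  y * Real.log (expit w) + (1 - y) * Real.log (1 - expit w)

lemma expit_pos (w : ℝ) : 0 < expit w := by unfold expit; positivity

lemma one_sub_expit_pos (w : ℝ) : 0 < 1 - expit w := by
  have h : 1 - expit w = 1 / (1 + Real.exp w) := by
    unfold expit
    have : 1 + Real.exp w ≠ 0 := by positivity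
    field_simp
    ring
  rw [h]; positivity

/-- Two-point Jensen / Gibbs inequality. -/
lemma two_point (a b a' b' : ℝ) (ha : 0 < a) (hb : 0 < b) (ha' : 0 < a') (hb' : 0 < b') :
    a / (b + a) * (Real.log a' - Real.log a) + (1 - a / (b + a)) * (Real.log b' - Real.log b)
      ≤ Real.log (b' + a') - Real.log (b + a) := by
  have key : ∀ x x' : ℝ, 0 < x → 0 < x' → Real.log x' - Real.log x + Real.log (b + a)
      - Real.log (b' + a') ≤ x' * (b + a) / (x * (b' + a')) - 1 := by
    intro x x' hx hx'
    have h := Real.log_le_sub_one_of_pos (show 0 < x' * (b + a) / (x * (b' + a')) by positivity)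
    rw [Real.log_div (by positivity) (by positivity), Real.log_mul (by positivity) (by positivity),
      Real.log_mul (by positivity) (by positivity)] at h
    linarith
  have e : 1 - a / (b + a) = b / (b + a) := by field_simp; ring
  have h1 := mul_le_mul_of_nonneg_left (key a a' ha ha') (show 0 ≤ a / (b + a) by positivity)
  have h2 := mul_le_mul_of_nonneg_left (key b b' hb hb') (show 0 ≤ b / (b + a) by positivity)
  have e1 : a / (b + a) * (a' * (b + a) / (a * (b' + a')) - 1)
      + b / (b + a) * (b' * (b + a) / (b * (b' + a')) - 1) = 0 := by
    field_simp; ring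
  have e2 : a / (b + a) = 1 - b / (b + a) := by linarith
  rw [e]
  rw [e2] at h1 e1 ⊢
  nlinarith

/-- Grouped Gibbs inequality. -/
lemma gibbs {ι κ : Type} [Fintype ι] [Fintype κ] [DecidableEq κ] [Nonempty ι] (f : ι → κ)
    (w : ι → ℝ) (q : κ → ℝ) (hw : ∀ i, 0 < w i) (hq : ∀ j, 0 ≤ q j) (hqs : ∑ j, q j = 1)
    (hqp : ∀ i, 0 < q (f i)) :
    (∀ i, 0 < (∑ i', if f i' = f i then w i' else 0) / ∑ i', w i') ∧
    ∑ i, w i * Real.log (q (f i)) ≤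
      ∑ i, w i * Real.log ((∑ i', if f i' = f i then w i' else 0) / ∑ i', w i') := by
  have hW : 0 < ∑ i', w i' := Finset.sum_pos (fun i _ => hw i) Finset.univ_nonempty
  have hc : ∀ i, 0 < ∑ i', if f i' = f i then w i' else 0 := by
    intro i
    refine Finset.sum_pos' (fun i' _ => ?_) ⟨i, Finset.mem_univ _, by simp [hw i]⟩
    split_ifs
    · exact (hw i').le
    · exact le_rfl
  have hp : ∀ i, 0 < (∑ i', if f i' = f i then w i' else 0) / ∑ i', w i' :=
    fun i => div_pos (hc i) hW
  refine ⟨hp, ?_⟩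
  set W := ∑ i', w i' with hWd
  set c : κ → ℝ := fun j => ∑ i', if f i' = j then w i' else 0 with hcd
  have hc' : ∀ i, 0 < c (f i) := hc
  have step : ∀ i, w i * Real.log (q (f i)) - w i * Real.log (c (f i) / W) ≤
      w i * (q (f i) * W / c (f i)) - w i := by
    intro i
    have h1 := hqp i
    have h2 := hc' i
    have h := Real.log_le_sub_one_of_pos (show 0 < q (f i) * W / c (f i) by positivity)
    rw [Real.log_div (by positivity) (by positivity),
      Real.log_mul (by positivity) (by positivity)] at h
    rw [Real.log_div (by positivity) (by positivity)]
    have := mul_le_mul_of_nonneg_left h (hw i).le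
    linarith
  have hs := Finset.sum_le_sum (fun i (_ : i ∈ Finset.univ) => step i)
  rw [Finset.sum_sub_distrib, Finset.sum_sub_distrib] at hs
  have hfib : ∑ i, w i * (q (f i) * W / c (f i)) = ∑ j, c j * (q j * W / c j) := by
    simp only [hcd, Finset.sum_mul]
    rw [Finset.sum_comm]
    refine Finset.sum_congr rfl fun i _ => ?_
    rw [Finset.sum_eq_single (f i)]
    · simp
    · intro j _ hj
      rw [if_neg (Ne.symm hj), zero_mul]
    · simp
  have hle : ∑ j, c j * (q j * W / c j) ≤ ∑ j, q j * W := by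
    refine Finset.sum_le_sum fun j _ => ?_
    by_cases h0 : c j = 0
    · rw [h0, zero_mul]; exact mul_nonneg (hq j) hW.le
    · rw [mul_div_cancel₀ _ h0]
  rw [← Finset.sum_mul, hqs, one_mul] at hle
  have : ∑ i, w i * Real.log (q (f i)) ≤ ∑ i, w i * Real.log (c (f i) / W) := by linarith
  exact this

/-- The EM inequality for one of the two blocks of the likelihood. -/
lemma block {ι κ : Type} [Fintype ι] [Fintype κ] [DecidableEq κ] [Nonempty ι] (f : ι → κ)
    (q0 q1 : κ → ℝ) (u u' Y : ι → ℝ)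
    (hq0 : ∀ j, 0 ≤ q0 j) (hqs0 : ∑ j, q0 j = 1) (hqp0 : ∀ i, 0 < q0 (f i))
    (hq1 : ∀ j, 0 ≤ q1 j) (hqs1 : ∑ j, q1 j = 1) (hqp1 : ∀ i, 0 < q1 (f i))
    (hY : ∀ i, Y i = q1 (f i) * expit (u i) /
      (q0 (f i) * (1 - expit (u i)) + q1 (f i) * expit (u i))) :
    (∑ i, loglik (Y i) (u' i)) - ∑ i, loglik (Y i) (u i) ≤
      (∑ i, Real.log
        (((∑ i', if f i' = f i then 1 - Y i' else 0) / ∑ i', (1 - Y i')) * (1 - expit (u' i))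
        + ((∑ i', if f i' = f i then Y i' else 0) / ∑ i', Y i') * expit (u' i)))
      - ∑ i, Real.log (q0 (f i) * (1 - expit (u i)) + q1 (f i) * expit (u i)) := by
  have ha : ∀ i, 0 < q1 (f i) * expit (u i) := fun i => mul_pos (hqp1 i) (expit_pos _)
  have hb : ∀ i, 0 < q0 (f i) * (1 - expit (u i)) :=
    fun i => mul_pos (hqp0 i) (one_sub_expit_pos _)
  have hY0 : ∀ i, 0 < Y i := fun i => by
    rw [hY]; exact div_pos (ha i) (add_pos (hb i) (ha i))
  have hY1 : ∀ i, 0 < 1 - Y i := fun i => by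
    rw [hY, sub_pos, div_lt_one (add_pos (hb i) (ha i))]; linarith [hb i]
  obtain ⟨p1, g1⟩ := gibbs f Y q1 hY0 hq1 hqs1 hqp1
  obtain ⟨p0, g0⟩ := gibbs f (fun i => 1 - Y i) q0 hY1 hq0 hqs0 hqp0
  set r1 : ι → ℝ := fun i => (∑ i', if f i' = f i then Y i' else 0) / ∑ i', Y i' with hr1
  set r0 : ι → ℝ := fun i =>
    (∑ i', if f i' = f i then 1 - Y i' else 0) / ∑ i', (1 - Y i') with hr0
  have p1' : ∀ i, 0 < r1 i := p1
  have p0' : ∀ i, 0 < r0 i := p0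
  have step : ∀ i, (loglik (Y i) (u' i) - loglik (Y i) (u i))
      + (Y i * Real.log (r1 i) - Y i * Real.log (q1 (f i)))
      + ((1 - Y i) * Real.log (r0 i) - (1 - Y i) * Real.log (q0 (f i))) ≤
      Real.log (r0 i * (1 - expit (u' i)) + r1 i * expit (u' i))
      - Real.log (q0 (f i) * (1 - expit (u i)) + q1 (f i) * expit (u i)) := by
    intro i
    have h := two_point _ _ _ _ (ha i) (hb i) (mul_pos (p1' i) (expit_pos (u' i)))
      (mul_pos (p0' i) (one_sub_expit_pos (u' i)))
    rw [← hY i, Real.log_mul (p1' i).ne' (expit_pos _).ne',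
      Real.log_mul (p0' i).ne' (one_sub_expit_pos _).ne',
      Real.log_mul (hqp1 i).ne' (expit_pos _).ne',
      Real.log_mul (hqp0 i).ne' (one_sub_expit_pos _).ne'] at h
    unfold loglik
    linarith
  have hs := Finset.sum_le_sum (fun i (_ : i ∈ Finset.univ) => step i)
  simp only [Finset.sum_sub_distrib, Finset.sum_add_distrib] at hs
  simp only [hr1, hr0] at hs
  simp only [Finset.sum_sub_distrib] at hs g0 g1 ⊢
  linarith

/-- Ascent property of the EM algorithm for the Stage II nonparametric log-likelihood:
one full EM step (E-step posterior weights at the current `η = (λ, s, ξ)`, then the explicit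
M-step updates for `λ` and `s` and a global maximizer for `ξ`) does not decrease `L`. -/
theorem em_ascent_nonparametric
    (n N K dg : ℕ) (hn : 1 ≤ n) (hNn : n ≤ N) (hK : 1 ≤ K) (hdg : 1 ≤ dg)
    (k : Fin n → Fin (K + 1))
    (v : Fin N → Fin dg → ℝ)
    (lam : Fin 2 → Fin (K + 1) → ℝ) (s : Fin N → Fin 2 → ℝ) (ξ : Fin dg → ℝ)
    (hlam_nonneg : ∀ y k', 0 ≤ lam y k')
    (hlam_sum : ∀ y, ∑ k', lam y k' = 1)
    (hlam_pos : ∀ y, ∀ i : Fin n, 0 < lam y (k i))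
    (hs_pos : ∀ i y, 0 < s i y)
    (hs_sum : ∀ y, ∑ i, s i y = 1) :
    -- the nonparametric log-likelihood `L(η)` with `η = (λ, s, ξ)`
    let L : (Fin 2 → Fin (K + 1) → ℝ) → (Fin N → Fin 2 → ℝ) → (Fin dg → ℝ) → ℝ :=
      fun la ss xi =>
        (∑ i : Fin n, Real.log (∑ y : Fin 2,
            la y (k i) * gY (y : ℕ) (∑ l, v (Fin.castLE hNn i) l * xi l)))
        + ∑ i : Fin N, Real.log (∑ y : Fin 2, ss i y * gY (y : ℕ) (∑ l, v i l * xi l))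
    -- E-step posterior weights at the current parameter
    let Y0 : Fin n → ℝ := fun i =>
      lam 1 (k i) * gY 1 (∑ l, v (Fin.castLE hNn i) l * ξ l) /
        ∑ y : Fin 2, lam y (k i) * gY (y : ℕ) (∑ l, v (Fin.castLE hNn i) l * ξ l)
    let Y1 : Fin N → ℝ := fun i =>
      s i 1 * gY 1 (∑ l, v i l * ξ l) /
        ∑ y : Fin 2, s i y * gY (y : ℕ) (∑ l, v i l * ξ l)
    -- explicit M-step updates for `λ` and `s`
    let lam' : Fin 2 → Fin (K + 1) → ℝ := fun y k' =>
      (∑ i : Fin n, if k i = k' then mix (y : ℕ) (Y0 i) else 0) /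
        ∑ i : Fin n, mix (y : ℕ) (Y0 i)
    let s' : Fin N → Fin 2 → ℝ := fun i y =>
      mix (y : ℕ) (Y1 i) / ∑ i' : Fin N, mix (y : ℕ) (Y1 i')
    ∀ ξ' : Fin dg → ℝ,
      (∀ ξ'' : Fin dg → ℝ,
        (∑ i : Fin n, loglik (Y0 i) (∑ l, v (Fin.castLE hNn i) l * ξ'' l))
          + ∑ i : Fin N, loglik (Y1 i) (∑ l, v i l * ξ'' l)
        ≤ (∑ i : Fin n, loglik (Y0 i) (∑ l, v (Fin.castLE hNn i) l * ξ' l))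
          + ∑ i : Fin N, loglik (Y1 i) (∑ l, v i l * ξ' l)) →
      L lam' s' ξ' ≥ L lam s ξ := by
  intro L Y0 Y1 lam' s' ξ' hmax
  have : Nonempty (Fin n) := ⟨⟨0, hn⟩⟩
  have : Nonempty (Fin N) := ⟨⟨0, by omega⟩⟩
  have h0 := block k (lam 0) (lam 1) (fun i => ∑ l, v (Fin.castLE hNn i) l * ξ l)
    (fun i => ∑ l, v (Fin.castLE hNn i) l * ξ' l) Y0
    (hlam_nonneg 0) (hlam_sum 0) (hlam_pos 0) (hlam_nonneg 1) (hlam_sum 1) (hlam_pos 1)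
    (by intro i; simp [Y0, gY, Fin.sum_univ_two])
  have h1 := block (fun i : Fin N => i) (fun i => s i 0) (fun i => s i 1)
    (fun i => ∑ l, v i l * ξ l) (fun i => ∑ l, v i l * ξ' l) Y1
    (fun i => (hs_pos i 0).le) (hs_sum 0) (fun i => hs_pos i 0)
    (fun i => (hs_pos i 1).le) (hs_sum 1) (fun i => hs_pos i 1)
    (by intro i; simp [Y1, gY, Fin.sum_univ_two])
  have hm := hmax ξ
  have eL : L lam s ξ = (∑ i, Real.log (lam 0 (k i) *
        (1 - expit (∑ l, v (Fin.castLE hNn i) l * ξ l))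
        + lam 1 (k i) * expit (∑ l, v (Fin.castLE hNn i) l * ξ l)))
      + ∑ i, Real.log (s i 0 * (1 - expit (∑ l, v i l * ξ l))
        + s i 1 * expit (∑ l, v i l * ξ l)) := by
    simp [L, gY, Fin.sum_univ_two]
  have eL' : L lam' s' ξ' = (∑ i, Real.log
        (((∑ i', if k i' = k i then 1 - Y0 i' else 0) / ∑ i', (1 - Y0 i'))
          * (1 - expit (∑ l, v (Fin.castLE hNn i) l * ξ' l))
        + ((∑ i', if k i' = k i then Y0 i' else 0) / ∑ i', Y0 i')
          * expit (∑ l, v (Fin.castLE hNn i) l * ξ' l)))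
      + ∑ i, Real.log
        (((∑ i', if i' = i then 1 - Y1 i' else 0) / ∑ i', (1 - Y1 i'))
          * (1 - expit (∑ l, v i l * ξ' l))
        + ((∑ i', if i' = i then Y1 i' else 0) / ∑ i', Y1 i')
          * expit (∑ l, v i l * ξ' l)) := by
    simp only [L, lam', s', gY, mix, Fin.sum_univ_two, Finset.sum_ite_eq', Finset.mem_univ, if_true]
    simp
  rw [eL, eL']
  linarith
end

section
/- Let (Ω, P) be a probability space, let Y : Ω → {0,1}, and let A, B ⊆ Ω be events with P(Y=0) > 0, P(Y=1) > 0, P(A) > 0 and P(B) > 0. Assume A and B are conditionally independent given Y, i.e. P(A ∩ B ∣ Y=y) = P(A ∣ Y=y) · P(B ∣ Y=y) for y ∈ {0,1}. Then ∑_{y=0}^1 P(Y=y ∣ A) · P(Y=y ∣ B) / P(Y=y) = P(A ∣ B) / P(A). -/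
open MeasureTheory

/-- Real-valued conditional probability `P(A ∣ B) = P(A ∩ B) / P(B)`. -/
noncomputable def condP {Ω : Type*} [MeasurableSpace Ω] (P : Measure Ω) (A B : Set Ω) : ℝ :=
  (P (A ∩ B)).toReal / (P B).toReal

/-- Composite-likelihood identity: if events `A` and `B` are conditionally independent given
the binary phenotype (event `E` = `{Y = 1}`), then
`∑_{y=0}^1 P(Y=y ∣ A)·P(Y=y ∣ B)/P(Y=y) = P(A ∣ B)/P(A)`. -/
theorem composite_likelihood_identity
    {Ω : Type*} [MeasurableSpace Ω] (P : Measure Ω) [IsProbabilityMeasure P]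
    (E A B : Set Ω) (hE : MeasurableSet E) (hA : MeasurableSet A) (hB : MeasurableSet B)
    (h0 : 0 < (P Eᶜ).toReal) (h1 : 0 < (P E).toReal)
    (hApos : 0 < (P A).toReal) (hBpos : 0 < (P B).toReal)
    (hCI1 : condP P (A ∩ B) E = condP P A E * condP P B E)
    (hCI0 : condP P (A ∩ B) Eᶜ = condP P A Eᶜ * condP P B Eᶜ) :
    condP P Eᶜ A * condP P Eᶜ B / (P Eᶜ).toReal
      + condP P E A * condP P E B / (P E).toReal
      = condP P A B / (P A).toReal := by
  have hsum : (P (A ∩ B)).toReal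
      = (P (A ∩ B ∩ E)).toReal + (P (A ∩ B ∩ Eᶜ)).toReal := by
    rw [← ENNReal.toReal_add (measure_ne_top P _) (measure_ne_top P _), ← Set.diff_eq,
      measure_inter_add_diff _ hE]
  unfold condP at *
  rw [Set.inter_comm Eᶜ A, Set.inter_comm Eᶜ B, Set.inter_comm E A, Set.inter_comm E B, hsum]
  have k1 : (P (A ∩ B ∩ E)).toReal = (P (A ∩ E)).toReal * (P (B ∩ E)).toReal / (P E).toReal := by
    field_simp at hCI1 ⊢
    linarith
  have k0 : (P (A ∩ B ∩ Eᶜ)).toReal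
      = (P (A ∩ Eᶜ)).toReal * (P (B ∩ Eᶜ)).toReal / (P Eᶜ).toReal := by
    field_simp at hCI0 ⊢
    linarith
  rw [k1, k0]
  field_simp
  ring
end
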